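/- Let F and F' be finite fields of orders q and q', and let G be a subgroup of the multiplicative group F \ {0} with 1 < |G| < q − 1 such that for every subgroup G' of F' \ {0} with |G'| < q' − 1, either |G| > |G'| or q − |G| > q' − |G'|. Write d = |G|. Let ω ≥ 3 be an integer such that for every positive divisor d' of q' − 1 with d' < d, ω ≥ ((q'−1)/d' − ⌈(q−d−1)/d'⌉)/(⌈d/d'⌉ − 1) + 1 (as real numbers). Then the ω-tuple (d, d, …, d, q−d−1) (with d repeated ω−1 times) is realizable over F but is NOT realizable over F'. -/

import Mathlib

/-- `Realizable F ω d` : there are subsets `S i ⊆ F \ {0}` with `|S i| = d i` such that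
`(-1)^(ω-1)` is not in the product set `S 1 ⋯ S ω`. -/
def Realizable (F : Type*) [Field F] (ω : ℕ) (d : Fin ω → ℕ) : Prop :=
  ∃ S : Fin ω → Finset F,
    (∀ i, (0 : F) ∉ S i) ∧ (∀ i, (S i).card = d i) ∧
    ∀ a : Fin ω → F, (∀ i, a i ∈ S i) → (-1 : F) ^ (ω - 1) ≠ ∏ i, a i

section KneserAux
open Finset Pointwise
set_option linter.unusedSectionVars false

variable {G : Type} [CommGroup G] [Fintype G] [DecidableEq G]

noncomputable def hs (H : Subgroup G) : Finset G := (Set.toFinite (H : Set G)).toFinset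

lemma mem_hs {H : Subgroup G} {x : G} : x ∈ hs H ↔ x ∈ H := by simp [hs]

lemma hs_card (H : Subgroup G) : (hs H).card = Nat.card H := by
  rw [hs, ← Set.ncard_eq_toFinset_card]; rfl

lemma hs_pos (H : Subgroup G) : 0 < (hs H).card :=
  card_pos.2 ⟨1, mem_hs.2 H.one_mem⟩

lemma mem_sat {H : Subgroup G} {A : Finset G} {x : G} :
    x ∈ A * hs H ↔ ∃ a ∈ A, a⁻¹ * x ∈ H := by
  rw [Finset.mem_mul]
  constructor
  · rintro ⟨a, ha, h, hh, rfl⟩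
    exact ⟨a, ha, by simpa using mem_hs.1 hh⟩
  · rintro ⟨a, ha, h⟩
    exact ⟨a, ha, _, mem_hs.2 h, by simp⟩

lemma sub_sat (H : Subgroup G) (A : Finset G) : A ⊆ A * hs H := fun a ha =>
  mem_sat.2 ⟨a, ha, by simp [H.one_mem]⟩

lemma hs_mul_hs {L H : Subgroup G} (h : L ≤ H) : hs H * hs L = hs H := by
  apply Subset.antisymm
  · intro x hx
    obtain ⟨a, ha, h'⟩ := mem_sat.1 hx
    have := H.mul_mem (mem_hs.1 ha) (h h')
    exact mem_hs.2 (by simpa using this)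
  · exact sub_sat _ _

lemma sat_sat {L H : Subgroup G} (h : L ≤ H) (A : Finset G) : A * hs H * hs L = A * hs H := by
  rw [mul_assoc, hs_mul_hs h]

lemma sat_dvd (H : Subgroup G) (A : Finset G) : (hs H).card ∣ (A * hs H).card := by
  apply card_dvd_card_mul_right
  rintro _ ⟨x, hx, rfl⟩ _ ⟨y, hy, rfl⟩ hxy
  simp only [Function.onFun, id]
  rw [disjoint_left]
  intro w hw hw'
  apply hxy
  obtain ⟨u, hu, rfl⟩ := mem_smul_finset.1 hw
  obtain ⟨v, hv, hv'⟩ := mem_smul_finset.1 hw'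
  rw [mem_hs] at hu hv
  simp only [smul_eq_mul] at hv'
  have hyx : y⁻¹ * x ∈ H := by
    have : y⁻¹ * x = v * u⁻¹ := by
      rw [inv_mul_eq_iff_eq_mul, ← mul_assoc, hv', mul_inv_cancel_right]
    rw [this]
    exact H.mul_mem hv (H.inv_mem hu)
  ext z
  simp only [mem_smul_finset, mem_hs, smul_eq_mul]
  constructor
  · rintro ⟨t, ht, rfl⟩
    exact ⟨y⁻¹ * x * t, H.mul_mem hyx ht, by group⟩
  · rintro ⟨t, ht, rfl⟩
    exact ⟨(y⁻¹ * x)⁻¹ * t, H.mul_mem (H.inv_mem hyx) ht, by group⟩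

lemma hs_dvd {L H : Subgroup G} (h : L ≤ H) : (hs L).card ∣ (hs H).card := by
  have := sat_dvd L (hs H)
  rwa [hs_mul_hs h] at this

lemma stable_stab (A : Finset G) : A * hs (MulAction.stabilizer G A) = A := by
  apply Subset.antisymm _ (sub_sat _ _)
  intro x hx
  obtain ⟨a, ha, h⟩ := mem_sat.1 hx
  rw [MulAction.mem_stabilizer_iff] at h
  rw [← h]
  have := smul_mem_smul_finset (a := a⁻¹ * x) ha
  simpa [mul_comm] using this

lemma le_stab {A : Finset G} {H : Subgroup G} (h : A * hs H = A) :
    H ≤ MulAction.stabilizer G A := by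
  intro g hg
  rw [MulAction.mem_stabilizer_iff]
  apply eq_of_subset_of_card_le
  · intro x hx
    obtain ⟨a, ha, rfl⟩ := mem_smul_finset.1 hx
    rw [← h]
    exact mem_sat.2 ⟨a, ha, by simpa [mul_comm] using hg⟩
  · simp

/-- Kneser inequality for a pair. -/
def Kn (A B : Finset G) : Prop :=
  (A * hs (MulAction.stabilizer G (A * B))).card + (B * hs (MulAction.stabilizer G (A * B))).card
    ≤ (A * B).card + (hs (MulAction.stabilizer G (A * B))).card

noncomputable def cs (H : Subgroup G) (a : G) : Finset G := a • hs H

lemma mem_cs {H : Subgroup G} {a x : G} : x ∈ cs H a ↔ a⁻¹ * x ∈ H := by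
  rw [cs, mem_smul_finset]
  constructor
  · rintro ⟨y, hy, rfl⟩
    simpa using mem_hs.1 hy
  · intro h
    exact ⟨_, mem_hs.2 h, by simp⟩

lemma cs_card (H : Subgroup G) (a : G) : (cs H a).card = (hs H).card := by simp [cs]

lemma kn_step {A B C X Y : Finset G} {H : Subgroup G} {a b : G}
    (IH1 : ∀ A' B' : Finset G, A'.Nonempty → B'.Nonempty → (A' * B').card < (A * B).card → Kn A' B')
    (hCne : C.Nonempty) (hCs : C ⊆ A * B) (hC : C * hs H = C)
    (hmin : ∀ (C' : Finset G) (H' : Subgroup G), (hs H').card < (hs H).card → C' ⊆ A * B →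
      C' * hs H' = C' → C'.card + (hs H').card < (A ∩ B).card + ((A ∪ B) * hs H').card)
    {z : G} (hz : z ∉ A * B) (hzH : (a * b)⁻¹ * z ∈ H)
    (hX : X ⊆ A) (hY : Y ⊆ B) (hXn : X.Nonempty) (hYn : Y.Nonempty)
    (hXY : ∀ x ∈ X, ∀ y ∈ Y, (a * b)⁻¹ * (x * y) ∈ H) :
    ∃ L : Subgroup G, L ≤ H ∧ C.card + (X * Y).card ≤ (A * B).card ∧
      (X * hs L).card + (Y * hs L).card ≤ (X * Y).card + (hs L).card ∧
      C.card + (X * Y).card + (hs L).card < (A ∩ B).card + ((A ∪ B) * hs L).card := by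
  have hXYs : X * Y ⊆ A * B := mul_subset_mul hX hY
  have hco : ∀ w ∈ X * Y, (a * b)⁻¹ * w ∈ H := by
    intro w hw
    obtain ⟨x, hx, y, hy, rfl⟩ := mem_mul.1 hw
    exact hXY x hx y hy
  have hdisj : Disjoint C (X * Y) := by
    rw [disjoint_left]
    intro w hw hw'
    apply hz
    apply hCs
    rw [← hC]
    refine mem_sat.2 ⟨w, hw, ?_⟩
    have := H.mul_mem (H.inv_mem (hco w hw')) hzH
    convert this using 1
    group
  have hcard : C.card + (X * Y).card ≤ (A * B).card := by
    rw [← card_union_of_disjoint hdisj]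
    exact card_le_card (union_subset hCs hXYs)
  have hCpos := card_pos.2 hCne
  have hKn := IH1 X Y hXn hYn (by omega)
  obtain ⟨w, hw⟩ := hXn.mul hYn
  have hst := stable_stab (X * Y)
  set L := MulAction.stabilizer G (X * Y) with hL
  have hLH : L ≤ H := by
    intro g hg
    have h1 : w * g ∈ X * Y := by
      rw [← hst]; exact mem_sat.2 ⟨w, hw, by simpa using hg⟩
    have := H.mul_mem (H.inv_mem (hco w hw)) (hco _ h1)
    convert this using 1
    group
  have hlt : (hs L).card < (hs H).card := by
    apply card_lt_card
    refine ⟨fun x hx => mem_hs.2 (hLH (mem_hs.1 hx)), fun hsub => hz (hXYs ?_)⟩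
    rw [← hst]
    refine mem_sat.2 ⟨w, hw, mem_hs.1 (hsub (mem_hs.2 ?_))⟩
    have := H.mul_mem (H.inv_mem (hco w hw)) hzH
    convert this using 1
    group
  refine ⟨L, hLH, hcard, hKn, ?_⟩
  have := hmin (C ∪ X * Y) L hlt (union_subset hCs hXYs) (by
    rw [union_mul, hst]
    congr 1
    rw [← hC, sat_sat hLH])
  rwa [card_union_of_disjoint hdisj] at this

lemma dvd_gap {h x y k : ℕ} (hx : h ∣ x) (hy : h ∣ y) (hk : h ∣ k) (hlt : x + y < k) :
    x + y + h ≤ k := by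
  have h1 : h ∣ k - (x + y) := Nat.dvd_sub hk (Nat.dvd_add hx hy)
  have := Nat.le_of_dvd (by omega) h1
  omega

lemma sat_mono {L H : Subgroup G} (h : L ≤ H) (A : Finset G) : A * hs L ⊆ A * hs H :=
  mul_subset_mul_left (fun _ hx => mem_hs.2 (h (mem_hs.1 hx)))

lemma sat_le {L H : Subgroup G} (h : L ≤ H) (A : Finset G) :
    (A * hs L).card ≤ (A * hs H).card := card_le_card (sat_mono h A)

lemma le_sat (H : Subgroup G) (A : Finset G) : A.card ≤ (A * hs H).card :=
  card_le_card (sub_sat H A)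

lemma hs_le_sat (H : Subgroup G) {A : Finset G} (hA : A.Nonempty) :
    (hs H).card ≤ (A * hs H).card := card_le_card_mul_left hA

set_option maxHeartbeats 1000000 in
lemma kn_core {A B : Finset G} (K : Subgroup G)
    (hK : ∀ H : Subgroup G, A * B * hs H = A * B → H ≤ K)
    (hAB : (A ∩ B).Nonempty) (hnAB : ¬ A ⊆ B)
    (IH1 : ∀ A' B' : Finset G, A'.Nonempty → B'.Nonempty → (A' * B').card < (A * B).card → Kn A' B')
    (IH3 : ∀ A' B' : Finset G, A'.Nonempty → B'.Nonempty → (A' * B').card = (A * B).card →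
      A'.card + B'.card = A.card + B.card → A'.card < A.card → Kn A' B') :
    A.card + B.card ≤ (A * B).card + (hs K).card := by
  by_contra! hcon
  have hIU := card_inter_add_card_union A B
  have hUne : (A ∪ B).Nonempty := hAB.mono (inter_subset_left.trans subset_union_left)
  have hex : ∃ n, ∃ (C : Finset G) (H : Subgroup G), (hs H).card = n ∧ C ⊆ A * B ∧ C * hs H = C ∧
      (A ∩ B).card + ((A ∪ B) * hs H).card ≤ C.card + (hs H).card := by
    have hsub : (A ∩ B) * (A ∪ B) ⊆ A * B := inter_mul_union_subset
    have hkn : Kn (A ∩ B) (A ∪ B) := by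
      rcases (card_le_card hsub).lt_or_eq with h | h
      · exact IH1 _ _ hAB hUne h
      · refine IH3 _ _ hAB hUne h hIU (card_lt_card ⟨inter_subset_left, fun h' => hnAB ?_⟩)
        exact h'.trans inter_subset_right
    refine ⟨_, (A ∩ B) * (A ∪ B), _, rfl, hsub, stable_stab _, ?_⟩
    have := le_sat (MulAction.stabilizer G ((A ∩ B) * (A ∪ B))) (A ∩ B)
    unfold Kn at hkn
    omega
  classical
  obtain ⟨C, H, hHn, hCs, hC, hconv⟩ := Nat.find_spec hex
  have hmin : ∀ (C' : Finset G) (H' : Subgroup G), (hs H').card < (hs H).card → C' ⊆ A * B →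
      C' * hs H' = C' → C'.card + (hs H').card < (A ∩ B).card + ((A ∪ B) * hs H').card := by
    intro C' H' h1 h2 h3
    by_contra! h4
    exact Nat.find_min hex (hHn ▸ h1) ⟨C', H', rfl, h2, h3, h4⟩
  clear hHn
  clear hex
  have hABpos := card_pos.2 hAB
  have hKpos := hs_pos K
  have hU := le_sat H (A ∪ B)
  have hCle := card_le_card hCs
  have hCne : C.Nonempty := by
    rw [nonempty_iff_ne_empty]
    rintro rfl
    have := hs_le_sat H hUne
    simp only [card_empty] at hconv
    omega
  have hHK : ¬ H ≤ K := by
    intro hle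
    have : (hs H).card ≤ (hs K).card := card_le_card fun x hx => mem_hs.2 (hle (mem_hs.1 hx))
    omega
  have hne : ¬ (A * B * hs H ⊆ A * B) := fun h => hHK (hK H (Subset.antisymm h (sub_sat _ _)))
  rw [not_subset] at hne
  obtain ⟨z, hz1, hz⟩ := hne
  obtain ⟨w, hw, hzH⟩ := mem_sat.1 hz1
  obtain ⟨a, ha, b, hb, rfl⟩ := mem_mul.1 hw
  have step := fun X Y => kn_step (X := X) (Y := Y) IH1 hCne hCs hC hmin hz hzH
  have haA1 : a ∈ A ∩ cs H a := mem_inter.2 ⟨ha, mem_cs.2 (by simp [H.one_mem])⟩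
  have hbB1 : b ∈ B ∩ cs H b := mem_inter.2 ⟨hb, mem_cs.2 (by simp [H.one_mem])⟩
  obtain ⟨L, hLH, e1, e2, e3⟩ := step (A ∩ cs H a) (B ∩ cs H b) inter_subset_left inter_subset_left
    ⟨a, haA1⟩ ⟨b, hbB1⟩ (by
      intro x hx y hy
      have := H.mul_mem (mem_cs.1 (mem_inter.1 hx).2) (mem_cs.1 (mem_inter.1 hy).2)
      convert this using 1
      rw [mul_inv, mul_mul_mul_comm])
  have d1 := sat_dvd L (A ∩ cs H a)
  have d2 := sat_dvd L (B ∩ cs H b)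
  have d3 := hs_dvd hLH
  have m1 := sat_le hLH (A ∪ B)
  have g1 := dvd_gap d1 d2 d3 (by omega)
  have hca : cs H a ⊆ (A ∪ B) * hs H := fun x hx =>
    mem_sat.2 ⟨a, mem_union_left _ ha, mem_cs.1 hx⟩
  have hcb : cs H b ⊆ (A ∪ B) * hs H := fun x hx =>
    mem_sat.2 ⟨b, mem_union_right _ hb, mem_cs.1 hx⟩
  by_cases hsame : a⁻¹ * b ∈ H
  · -- same coset
    have hcs : cs H b = cs H a := by
      ext x
      rw [mem_cs, mem_cs]
      have : a⁻¹ * x = (a⁻¹ * b) * (b⁻¹ * x) := by group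
      rw [this]
      exact (H.mul_mem_cancel_left hsame).symm
    have hsub : (A ∪ B) * hs L ∪ cs H a ⊆ (A ∪ B) * hs H :=
      union_subset (sat_mono hLH _) hca
    have h1 := card_le_card hsub
    have h2 := card_inter_add_card_union ((A ∪ B) * hs L) (cs H a)
    have h3 : ((A ∪ B) * hs L) ∩ cs H a ⊆ (A ∩ cs H a) * hs L ∪ (B ∩ cs H b) * hs L := by
      intro x hx
      obtain ⟨hx1, hx2⟩ := mem_inter.1 hx
      obtain ⟨u, hu, hux⟩ := mem_sat.1 hx1
      have huc : u ∈ cs H a := by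
        rw [mem_cs] at hx2 ⊢
        have := H.mul_mem hx2 (H.inv_mem (hLH hux))
        convert this using 1
        group
      rcases mem_union.1 hu with hu | hu
      · exact mem_union_left _ (mem_sat.2 ⟨u, mem_inter.2 ⟨hu, huc⟩, hux⟩)
      · exact mem_union_right _ (mem_sat.2 ⟨u, mem_inter.2 ⟨hu, hcs ▸ huc⟩, hux⟩)
    have h4 := (card_le_card h3).trans (card_union_le _ _)
    rw [cs_card] at h2
    omega
  · have hd : Disjoint (cs H a) (cs H b) := by
      rw [disjoint_left]
      intro x hx hy
      apply hsame
      have := H.mul_mem (mem_cs.1 hx) (H.inv_mem (mem_cs.1 hy))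
      convert this using 1
      group
    have hsub : (A ∪ B) ∪ (cs H a ∪ cs H b) ⊆ (A ∪ B) * hs H :=
      union_subset (sub_sat _ _) (union_subset hca hcb)
    have h1 := card_le_card hsub
    have h2 := card_inter_add_card_union (A ∪ B) (cs H a ∪ cs H b)
    rw [card_union_of_disjoint hd, cs_card, cs_card] at h2
    have h3 : (A ∪ B) ∩ (cs H a ∪ cs H b) =
        ((A ∩ cs H a) ∪ (B ∩ cs H a)) ∪ ((A ∩ cs H b) ∪ (B ∩ cs H b)) := by
      ext x; simp only [mem_inter, mem_union]; tauto
    have h4 := card_union_le ((A ∩ cs H a) ∪ (B ∩ cs H a)) ((A ∩ cs H b) ∪ (B ∩ cs H b))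
    have h5 := card_union_le (A ∩ cs H a) (B ∩ cs H a)
    have h6 := card_union_le (A ∩ cs H b) (B ∩ cs H b)
    rw [← h3] at h4
    have i1 := le_sat L (A ∩ cs H a)
    have i2 := le_sat L (B ∩ cs H b)
    have j1 := hs_le_sat L ⟨a, haA1⟩
    have j2 := hs_le_sat L ⟨b, hbB1⟩
    have k1 : (A ∩ cs H b).card ≤ (hs H).card := by
      rw [← cs_card H b]; exact card_le_card inter_subset_right
    have k2 : (B ∩ cs H a).card ≤ (hs H).card := by
      rw [← cs_card H a]; exact card_le_card inter_subset_right
    have k3 : ((A ∩ cs H a) ∪ (B ∩ cs H a)).card ≤ (hs H).card := by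
      rw [← cs_card H a]; exact card_le_card (union_subset inter_subset_right inter_subset_right)
    have k4 : ((A ∩ cs H b) ∪ (B ∩ cs H b)).card ≤ (hs H).card := by
      rw [← cs_card H b]; exact card_le_card (union_subset inter_subset_right inter_subset_right)
    rcases (B ∩ cs H a).eq_empty_or_nonempty with hB2 | hB2
    · have := card_eq_zero.2 hB2
      omega
    rcases (A ∩ cs H b).eq_empty_or_nonempty with hA2 | hA2
    · have := card_eq_zero.2 hA2
      omega
    obtain ⟨L', hLH', e1', e2', e3'⟩ := step (A ∩ cs H b) (B ∩ cs H a)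
      inter_subset_left inter_subset_left hA2 hB2 (by
        intro x hx y hy
        have := H.mul_mem (mem_cs.1 (mem_inter.1 hx).2) (mem_cs.1 (mem_inter.1 hy).2)
        convert this using 1
        rw [mul_comm a b, mul_inv, mul_mul_mul_comm])
    have d1' := sat_dvd L' (A ∩ cs H b)
    have d2' := sat_dvd L' (B ∩ cs H a)
    have d3' := hs_dvd hLH'
    have m1' := sat_le hLH' (A ∪ B)
    have g1' := dvd_gap d1' d2' d3' (by omega)
    have i1' := le_sat L' (A ∩ cs H b)
    have i2' := le_sat L' (B ∩ cs H a)
    omega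

lemma stab_smul (x : G) (S : Finset G) :
    ∀ H : Subgroup G, x • S * hs H = x • S → H ≤ MulAction.stabilizer G S := by
  intro H h
  apply le_stab
  rw [smul_mul_assoc] at h
  exact smul_left_cancel x h

theorem kneser_aux : ∀ n m l : ℕ, ∀ A B : Finset G, A.Nonempty → B.Nonempty → (A * B).card = n →
    2 * Fintype.card G - (A.card + B.card) = m → A.card = l → Kn A B := by
  intro n
  induction n using Nat.strong_induction_on with
  | _ n IHn =>
  intro m
  induction m using Nat.strong_induction_on with
  | _ m IHm =>
  intro l
  induction l using Nat.strong_induction_on with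
  | _ l IHl =>
  intro A B hA hB hn hm hl
  have hst := stable_stab (A * B)
  have hAu := card_le_univ A
  have hBu := card_le_univ B
  by_cases hstab : A.card + B.card <
      (A * hs (MulAction.stabilizer G (A * B))).card + (B * hs (MulAction.stabilizer G (A * B))).card
  · set K := MulAction.stabilizer G (A * B) with hKdef
    have hAB' : (A * hs K) * (B * hs K) = A * B := by
      rw [mul_mul_mul_comm, hs_mul_hs le_rfl, hst]
    have hAu' := card_le_univ (A * hs K)
    have hBu' := card_le_univ (B * hs K)
    have := IHm (2 * Fintype.card G - ((A * hs K).card + (B * hs K).card)) (by omega) _ (A * hs K) (B * hs K) (hA.mono (sub_sat _ _)) (hB.mono (sub_sat _ _))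
      (by rw [hAB', hn]) rfl rfl
    unfold Kn at this
    rw [hAB', ← hKdef, sat_sat le_rfl, sat_sat le_rfl] at this
    exact this
  unfold Kn
  set K := MulAction.stabilizer G (A * B) with hKdef
  have hA1 := le_sat K A
  have hB1 := le_sat K B
  suffices A.card + B.card ≤ (A * B).card + (hs K).card by omega
  have hAK : A * hs K = A := (eq_of_subset_of_card_le (sub_sat _ _) (by omega)).symm
  obtain ⟨a, ha⟩ := hA
  by_cases hAs : A ⊆ cs K a
  · have h1 := card_le_card hAs
    rw [cs_card] at h1
    have h2 : B.card ≤ (A * B).card := card_le_card_mul_left ⟨a, ha⟩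
    omega
  rw [not_subset] at hAs
  obtain ⟨a', ha', hna⟩ := hAs
  rw [mem_cs] at hna
  have hex : ∃ b ∈ B, (a⁻¹ * a') * b ∉ B := by
    by_contra! hall
    apply hna
    have hsm : (a⁻¹ * a') • B = B := by
      apply eq_of_subset_of_card_le
      · intro y hy
        obtain ⟨b, hb, rfl⟩ := mem_smul_finset.1 hy
        exact hall b hb
      · simp
    rw [hKdef, MulAction.mem_stabilizer_iff, ← mul_smul_comm, hsm]
  obtain ⟨b, hb, hnb⟩ := hex
  have e : A * ((a * b⁻¹) • B) = (a * b⁻¹) • (A * B) := mul_smul_comm _ _ _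
  have ec : (A * ((a * b⁻¹) • B)).card = (A * B).card := by rw [e]; simp
  have := kn_core (A := A) (B := (a * b⁻¹) • B) K (by
      intro H hH
      rw [e] at hH
      exact stab_smul _ _ H hH)
    ⟨a, mem_inter.2 ⟨ha, mem_smul_finset.2 ⟨b, hb, by simp⟩⟩⟩
    (by
      intro hsub
      obtain ⟨y, hy, hy'⟩ := mem_smul_finset.1 (hsub ha')
      apply hnb
      convert hy using 1
      rw [← hy', smul_eq_mul]
      rw [← mul_assoc, inv_mul_cancel_left, mul_right_comm, inv_mul_cancel, one_mul])
    (by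
      intro A' B' h1 h2 h3
      rw [ec, hn] at h3
      exact IHn _ h3 _ _ A' B' h1 h2 rfl rfl rfl)
    (by
      intro A' B' h1 h2 h3 h4 h5
      rw [card_smul_finset] at h4
      rw [ec, hn] at h3
      exact IHl _ (by omega) A' B' h1 h2 h3 (by omega) rfl)
  rwa [ec, card_smul_finset] at this

theorem kneser (A B : Finset G) (hA : A.Nonempty) (hB : B.Nonempty) : Kn A B :=
  kneser_aux _ _ _ A B hA hB rfl rfl rfl

theorem kneser_prod {ι : Type} [Fintype ι] [DecidableEq ι] (S : ι → Finset G)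
    (hS : ∀ i, (S i).Nonempty) (K : Subgroup G)
    (hK : K = MulAction.stabilizer G (∏ i, S i)) (s : Finset ι) :
    (hs K).card + ∑ i ∈ s, (S i * hs K).card ≤ ((∏ i ∈ s, S i) * hs K).card + s.card * (hs K).card := by
  have hst := stable_stab (∏ i, S i)
  rw [← hK] at hst
  have hne : ∀ s : Finset ι, (∏ i ∈ s, S i).Nonempty := by
    intro s
    induction s using Finset.induction_on with
    | empty => simp
    | insert i s hi ih => rw [prod_insert hi]; exact (hS i).mul ih
  have hstab : ∀ s : Finset ι, MulAction.stabilizer G ((∏ i ∈ s, S i) * hs K) = K := by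
    intro s
    apply le_antisymm
    · intro g hg
      rw [MulAction.mem_stabilizer_iff] at hg
      rw [hK, MulAction.mem_stabilizer_iff, ← hst, ← prod_mul_prod_compl s S, mul_right_comm,
        ← smul_mul_assoc, hg]
    · exact le_stab (sat_sat le_rfl _)
  induction s using Finset.induction_on with
  | empty => simp
  | insert i s hi ih =>
    have hk := kneser ((∏ i ∈ s, S i) * hs K) (S i) ((hne s).mono (sub_sat _ _)) (hS i)
    have e : (∏ i ∈ s, S i) * hs K * S i = (∏ i ∈ insert i s, S i) * hs K := by
      rw [prod_insert hi, mul_comm (S i), mul_right_comm]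
    unfold Kn at hk
    rw [e, hstab, sat_sat le_rfl] at hk
    rw [sum_insert hi, card_insert_of_notMem hi, add_mul, one_mul]
    omega

end KneserAux

section MainAux
open Finset Pointwise

lemma real_part {F : Type} [Field F] [Fintype F] (q : ℕ) (hF : Fintype.card F = q)
    (G : Subgroup Fˣ) (d : ℕ) (hd : d = Nat.card G) (n : ℕ) :
    Realizable F (n + 1) (fun i => if (i : ℕ) = n + 1 - 1 then q - d - 1 else d) := by
  classical
  have hcu : Fintype.card Fˣ = q - 1 := by rw [Fintype.card_units, hF]
  refine ⟨fun i => if (i : ℕ) = n + 1 - 1 then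
    ((cs G ((-1) ^ n))ᶜ).map ⟨Units.val, Units.val_injective⟩ else
    (hs G).map ⟨Units.val, Units.val_injective⟩, ?_, ?_, ?_⟩
  · intro i h
    dsimp only at h
    split_ifs at h
    · obtain ⟨u, _, hu⟩ := mem_map.1 h
      exact u.ne_zero hu
    · obtain ⟨u, _, hu⟩ := mem_map.1 h
      exact u.ne_zero hu
  · intro i
    dsimp only
    split_ifs
    · rw [card_map, card_compl, cs_card, hs_card, hcu, ← hd]
      omega
    · rw [card_map, hs_card, hd]
  · intro a ha heq
    have h1 : ∀ i : Fin n, ∃ u ∈ G, (u : F) = a i.castSucc := by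
      intro i
      have := ha i.castSucc
      dsimp only at this
      rw [if_neg (by have := i.2; simp only [Fin.val_castSucc]; omega)] at this
      obtain ⟨u, hu, hu'⟩ := mem_map.1 this
      exact ⟨u, mem_hs.1 hu, hu'⟩
    choose u hu hua using h1
    have h2 := ha (Fin.last n)
    dsimp only at h2
    rw [if_pos (by simp)] at h2
    obtain ⟨v, hv, hva⟩ := mem_map.1 h2
    rw [mem_compl, mem_cs] at hv
    apply hv
    rw [Fin.prod_univ_castSucc] at heq
    have h3 : ((-1 : Fˣ)) ^ n = (∏ i, u i) * v := by
      apply Units.ext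
      push_cast
      rw [Nat.add_sub_cancel] at heq
      rw [heq, ← hva]
      simp [hua]
    rw [h3, mul_inv, inv_mul_cancel_right]
    exact G.inv_mem (G.prod_mem fun i _ => hu i)

lemma ceil_le_sat {G : Type} [CommGroup G] [Fintype G] [DecidableEq G] (K : Subgroup G)
    (A : Finset G) (x : ℝ) (hx : x ≤ A.card) :
    (⌈x / ((hs K).card : ℝ)⌉ : ℝ) * (hs K).card ≤ (A * hs K).card := by
  obtain ⟨m, hm⟩ := sat_dvd K A
  have hp : (0 : ℝ) < (hs K).card := by exact_mod_cast hs_pos K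
  have h1 : (A.card : ℝ) ≤ (A * hs K).card := by exact_mod_cast le_sat K A
  have h2 : ⌈x / ((hs K).card : ℝ)⌉ ≤ (m : ℤ) := by
    rw [Int.ceil_le, div_le_iff₀ hp]
    rw [hm] at h1
    push_cast at h1 ⊢
    linarith
  have h3 : (⌈x / ((hs K).card : ℝ)⌉ : ℝ) ≤ m := by exact_mod_cast h2
  rw [hm]
  push_cast
  nlinarith

lemma not_real {G : Type} [CommGroup G] [Fintype G] [DecidableEq G] (q q' d n : ℕ)
    (hG : Fintype.card G + 1 = q')
    (hd1 : 1 < d) (hd2 : d < q - 1)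
    (hcrit : ∀ G' : Subgroup G, Nat.card G' < q' - 1 →
      Nat.card G' < d ∨ (q' : ℤ) - (Nat.card G' : ℤ) < (q : ℤ) - (d : ℤ))
    (hωbound : ∀ d' : ℕ, 0 < d' → d' ∣ q' - 1 → d' < d →
      ((n + 1 : ℕ) : ℝ) ≥ (((q' : ℝ) - 1) / (d' : ℝ) - (⌈((q : ℝ) - (d : ℝ) - 1) / (d' : ℝ)⌉ : ℝ))
          / ((⌈(d : ℝ) / (d' : ℝ)⌉ : ℝ) - 1) + 1)
    (S : Fin (n + 1) → Finset G) (hS : ∀ i : Fin n, (S i.castSucc).card = d)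
    (hSl : (S (Fin.last n)).card = q - d - 1) (e : G) : e ∈ ∏ i, S i := by
  by_contra he
  have hne : ∀ i, (S i).Nonempty := by
    intro i
    rw [← card_pos]
    induction i using Fin.lastCases with
    | last => omega
    | cast i => rw [hS]; omega
  obtain ⟨K, hK⟩ : ∃ K, K = MulAction.stabilizer G (∏ i, S i) := ⟨_, rfl⟩
  have hkn := kneser_prod S hne K hK univ
  have hst : (∏ i, S i) * hs K = ∏ i, S i := by rw [hK]; exact stable_stab _
  rw [hst, Fin.sum_univ_castSucc, card_univ, Fintype.card_fin] at hkn
  have hsub : S (Fin.last n) * hs K ⊆ S (Fin.last n) * hs K := Subset.rfl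
  have hdis : Disjoint (∏ i, S i) (cs K e) := by
    rw [disjoint_left]
    intro x hx hx'
    apply he
    rw [← hst]
    refine mem_sat.2 ⟨x, hx, ?_⟩
    have := K.inv_mem (mem_cs.1 hx')
    simpa using this
  have hN : (∏ i, S i).card + (hs K).card ≤ q' - 1 := by
    rw [← cs_card K e, ← card_union_of_disjoint hdis]
    have := card_le_univ ((∏ i, S i) ∪ cs K e)
    omega
  have hTP : q - d - 1 ≤ (∏ i, S i).card := by
    rw [Fin.prod_univ_castSucc, ← hSl]
    apply card_le_card_mul_left
    rw [← card_pos]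
    apply Nat.pos_of_ne_zero
    intro h0
    rw [card_eq_zero] at h0
    have h7 : (∏ i, S i).Nonempty := by
      have h8 : ∀ s : Finset (Fin (n+1)), (∏ i ∈ s, S i).Nonempty := by
        intro s
        induction s using Finset.induction_on with
        | empty => simp
        | insert i s hi ih => rw [prod_insert hi]; exact (hne i).mul ih
      exact h8 univ
    rw [Fin.prod_univ_castSucc, h0] at h7
    simp at h7
  have hkpos := hs_pos K
  have hkd : (hs K).card ∣ q' - 1 := by
    rw [hs_card, ← hG, Nat.add_sub_cancel, ← Nat.card_eq_fintype_card]
    exact Subgroup.card_subgroup_dvd_card K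
  have hc := hcrit K (by rw [← hs_card]; omega)
  rw [← hs_card] at hc
  rcases hc with hc | hc
  · have hb := hωbound _ hkpos hkd hc
    have c1 : ∀ i : Fin n, (⌈(d : ℝ) / ((hs K).card : ℝ)⌉ : ℝ) * (hs K).card
        ≤ (S i.castSucc * hs K).card := fun i => ceil_le_sat K _ _ (by rw [hS])
    have c2 := ceil_le_sat K (S (Fin.last n)) ((q : ℝ) - d - 1) (by
      rw [hSl]
      have : q = (q - d - 1) + d + 1 := by omega
      have : (q : ℝ) = ((q - d - 1 : ℕ) : ℝ) + d + 1 := by exact_mod_cast this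
      linarith)
    have c3 := Finset.sum_le_sum fun i (_ : i ∈ (univ : Finset (Fin n))) => c1 i
    rw [sum_const, card_univ, Fintype.card_fin, nsmul_eq_mul] at c3
    have hkn' : ((hs K).card : ℝ) + (∑ i : Fin n, ((S i.castSucc * hs K).card : ℝ) +
      (S (Fin.last n) * hs K).card) ≤ (∏ i, S i).card + (n + 1) * (hs K).card := by
      exact_mod_cast hkn
    have hN' : ((∏ i, S i).card : ℝ) + (hs K).card + 1 ≤ q' := by
      have : (∏ i, S i).card + (hs K).card + 1 ≤ q' := by omega
      exact_mod_cast this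
    have hp : (0 : ℝ) < (hs K).card := by exact_mod_cast hkpos
    have hce : (1 : ℝ) < ⌈(d : ℝ) / ((hs K).card : ℝ)⌉ := by
      have h1 : (1 : ℝ) < (d : ℝ) / ((hs K).card : ℝ) := by
        rw [lt_div_iff₀ hp, one_mul]; exact_mod_cast hc
      exact h1.trans_le (Int.le_ceil _)
    generalize (⌈(d : ℝ) / ((hs K).card : ℝ)⌉ : ℝ) = X at *
    generalize (⌈((q : ℝ) - d - 1) / ((hs K).card : ℝ)⌉ : ℝ) = Y at *
    generalize ((hs K).card : ℝ) = k at *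
    push_cast at hb
    have hb' : (((q' : ℝ) - 1) / k - Y) / (X - 1) ≤ n := by linarith
    rw [div_le_iff₀ (by linarith), sub_le_iff_le_add, div_le_iff₀ hp] at hb'
    nlinarith
  · omega

end MainAux

theorem subgroup_order_criterion_implies_realizable
    (F F' : Type) [Field F] [Fintype F] [Field F'] [Fintype F']
    (q q' : ℕ) (hF : Fintype.card F = q) (hF' : Fintype.card F' = q')
    (G : Subgroup Fˣ) (d : ℕ) (hd : d = Nat.card G)
    (hd1 : 1 < d) (hd2 : d < q - 1)
    (hcrit : ∀ G' : Subgroup F'ˣ, Nat.card G' < q' - 1 →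
      Nat.card G' < d ∨ (q' : ℤ) - (Nat.card G' : ℤ) < (q : ℤ) - (d : ℤ))
    (ω : ℕ) (hω : 3 ≤ ω)
    (hωbound : ∀ d' : ℕ, 0 < d' → d' ∣ q' - 1 → d' < d →
      (ω : ℝ) ≥ (((q' : ℝ) - 1) / (d' : ℝ) - (⌈((q : ℝ) - (d : ℝ) - 1) / (d' : ℝ)⌉ : ℝ))
          / ((⌈(d : ℝ) / (d' : ℝ)⌉ : ℝ) - 1) + 1) :
    Realizable F ω (fun i => if (i : ℕ) = ω - 1 then q - d - 1 else d) ∧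
    ¬ Realizable F' ω (fun i => if (i : ℕ) = ω - 1 then q - d - 1 else d) := by
  classical
  obtain ⟨n, rfl⟩ : ∃ n, ω = n + 1 := ⟨ω - 1, by omega⟩
  refine ⟨real_part q hF G d hd n, ?_⟩
  rintro ⟨S, h0, hc, hp⟩
  have hG : Fintype.card F'ˣ + 1 = q' := by
    rw [Fintype.card_units, hF']
    have : 0 < Fintype.card F' := Fintype.card_pos
    omega
  have hcard : ∀ i, (Finset.univ.filter fun u : F'ˣ => (u : F') ∈ S i).card = (S i).card := by
    intro i
    rw [← Finset.card_map ⟨Units.val, Units.val_injective⟩]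
    congr 1
    ext x
    simp only [Finset.mem_map, Finset.mem_filter, Finset.mem_univ, true_and,
      Function.Embedding.coeFn_mk]
    constructor
    · rintro ⟨u, hu, rfl⟩
      exact hu
    · intro hx
      have hx0 : x ≠ 0 := fun h => h0 i (h ▸ hx)
      exact ⟨Units.mk0 x hx0, by simpa using hx, rfl⟩
  have := not_real q q' d n hG hd1 hd2 hcrit hωbound
    (fun i => Finset.univ.filter fun u : F'ˣ => (u : F') ∈ S i)
    (by
      intro i
      rw [hcard, hc]
      dsimp only
      rw [if_neg]
      have := i.2
      simp only [Fin.val_castSucc]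
      omega)
    (by
      rw [hcard, hc]
      dsimp only
      rw [if_pos]
      simp) ((-1) ^ n)
  rw [← Finset.mem_coe, Finset.coe_prod, Set.mem_fintype_prod] at this
  obtain ⟨g, hg, hg'⟩ := this
  apply hp (fun i => (g i : F'))
  · intro i
    have := hg i
    simpa using this
  · rw [Nat.add_sub_cancel]
    have := congrArg Units.val hg'
    push_cast at this
    exact this.symm
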